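/- arXiv:2202.11173 — 4 statements merged into one kernel-verified Lean document; each statement's English description precedes it below -/
import Mathlib

section
/- For every function u ∈ C¹([a,b]) and every ε > 0, the normalized energy satisfies E_ε[u] ≥ (p/(p−1))^{(p−1)/p} ∫_a^b F(u(x))^{(p−1)/p} |u'(x)| dx. -/
open Set MeasureTheory intervalIntegral Filter Topology

noncomputable def F (θ u : ℝ) : ℝ := (1 / (2 * θ)) * |1 - u ^ 2| ^ θ

noncomputable def F' (θ u : ℝ) : ℝ := -u * (1 - u ^ 2) * |1 - u ^ 2| ^ (θ - 2)

noncomputable def Eeps (a b p θ ε : ℝ) (u : ℝ → ℝ) : ℝ :=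
  ∫ x in a..b, (ε ^ (p - 1) * |deriv u x| ^ p / p + F θ (u x) / ε)

noncomputable def cp (p θ : ℝ) : ℝ :=
  (p / (p - 1)) ^ ((p - 1) / p) * ∫ s in (-1 : ℝ)..1, (F θ s) ^ ((p - 1) / p)

lemma F_nonneg_aux (θ u : ℝ) (hθ : 1 < θ) : 0 ≤ F θ u := by
  unfold F; positivity

lemma young_aux (p ε d f : ℝ) (hp : 1 < p) (hε : 0 < ε) (hd : 0 ≤ d) (hf : 0 ≤ f) :
    (p / (p - 1)) ^ ((p - 1) / p) * (f ^ ((p - 1) / p) * d) ≤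
      ε ^ (p - 1) * d ^ p / p + f / ε := by
  have hp0 : 0 < p := by linarith
  have hp1 : 0 < p - 1 := by linarith
  have hq : p.HolderConjugate (p / (p - 1)) := Real.HolderConjugate.conjExponent hp
  have hy := Real.young_inequality_of_nonneg (a := ε ^ ((p - 1) / p) * d)
    (b := (p / (p - 1) * f / ε) ^ ((p - 1) / p)) (by positivity) (by positivity) hq
  have h1 : (ε ^ ((p - 1) / p) * d) ^ p = ε ^ (p - 1) * d ^ p := by
    rw [Real.mul_rpow (by positivity) hd, ← Real.rpow_mul hε.le]
    congr 2
    field_simp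
  have h2 : ((p / (p - 1) * f / ε) ^ ((p - 1) / p)) ^ (p / (p - 1)) = p / (p - 1) * f / ε := by
    rw [← Real.rpow_mul (by positivity)]
    have : (p - 1) / p * (p / (p - 1)) = 1 := by field_simp
    rw [this, Real.rpow_one]
  rw [h1, h2] at hy
  have h3 : p / (p - 1) * f / ε / (p / (p - 1)) = f / ε := by field_simp
  rw [h3, Real.div_rpow (by positivity) hε.le, Real.mul_rpow (by positivity) hf] at hy
  have he : ε ^ ((p - 1) / p) ≠ 0 := by positivity
  refine le_trans (le_of_eq ?_) hy
  field_simp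

theorem stmt0 (a b p θ ε : ℝ) (hab : a < b) (hp : 1 < p) (hθ : 1 < θ) (hε : 0 < ε)
    (u : ℝ → ℝ) (hu : ContDiffOn ℝ 1 u (Set.Icc a b)) :
    Eeps a b p θ ε u ≥
      (p / (p - 1)) ^ ((p - 1) / p) *
        ∫ x in a..b, (F θ (u x)) ^ ((p - 1) / p) * |deriv u x| := by
  have hp0 : 0 < p := by linarith
  have hp1 : 0 < p - 1 := by linarith
  have hv : ContinuousOn (derivWithin u (Icc a b)) (Icc a b) :=
    hu.continuousOn_derivWithin (uniqueDiffOn_Icc hab) le_rfl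
  have hF : ContinuousOn (fun x => F θ (u x)) (Icc a b) := by
    unfold F
    refine continuousOn_const.mul (ContinuousOn.rpow_const ?_ (fun x _ => Or.inr (by linarith)))
    exact (continuousOn_const.sub (hu.continuousOn.pow 2)).abs
  have hd : ∀ x ∈ Ioo a b, deriv u x = derivWithin u (Icc a b) x := fun x hx =>
    (derivWithin_of_mem_nhds (Icc_mem_nhds hx.1 hx.2)).symm
  have key : ∀ G : ℝ → ℝ → ℝ, ∫ x in a..b, G x (deriv u x) =
      ∫ x in a..b, G x (derivWithin u (Icc a b) x) := by
    intro G
    rw [integral_of_le hab.le, integral_of_le hab.le, integral_Ioc_eq_integral_Ioo,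
      integral_Ioc_eq_integral_Ioo]
    exact setIntegral_congr_fun measurableSet_Ioo (fun x hx => by simp only [hd x hx])
  unfold Eeps
  rw [key (fun x d => ε ^ (p - 1) * |d| ^ p / p + F θ (u x) / ε),
    key (fun x d => (F θ (u x)) ^ ((p - 1) / p) * |d|), ge_iff_le,
    ← intervalIntegral.integral_const_mul]
  apply intervalIntegral.integral_mono_on hab.le
  · apply ContinuousOn.intervalIntegrable_of_Icc hab.le
    exact continuousOn_const.mul
      ((hF.rpow_const (fun x _ => Or.inr (by positivity))).mul hv.abs)
  · apply ContinuousOn.intervalIntegrable_of_Icc hab.le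
    exact ((continuousOn_const.mul
      (hv.abs.rpow_const (fun x _ => Or.inr hp0.le))).div_const _).add (hF.div_const _)
  · intro x _
    exact young_aux p ε _ _ hp hε (abs_nonneg _) (F_nonneg_aux θ _ hθ)
end

section
/- For every function u ∈ C¹([a,b]) with u(a) = −1 and u(b) = 1 (or u(a) = 1 and u(b) = −1), and every ε > 0, the normalized energy satisfies E_ε[u] ≥ c_p, where c_p := (p/(p−1))^{(p−1)/p} ∫_{−1}^{1} F(s)^{(p−1)/p} ds. -/
open Set MeasureTheory intervalIntegral Filter Topology

lemma F_nonneg' {θ : ℝ} (hθ : 1 < θ) (s : ℝ) : 0 ≤ F θ s := by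
  unfold F; positivity

lemma F_cont {θ : ℝ} (hθ : 1 < θ) : Continuous (F θ) := by
  unfold F
  refine continuous_const.mul (Continuous.rpow_const (by fun_prop) ?_)
  intro x; right; linarith

lemma young_pt {p ε f d : ℝ} (hp : 1 < p) (hε : 0 < ε) (hf : 0 ≤ f) (hd : 0 ≤ d) :
    (p / (p - 1)) ^ ((p - 1) / p) * (f ^ ((p - 1) / p) * d)
      ≤ ε ^ (p - 1) * d ^ p / p + f / ε := by
  have hp0 : 0 < p := by linarith
  have hp1 : 0 < p - 1 := by linarith
  have hpq : p.HolderConjugate (p / (p - 1)) := Real.HolderConjugate.conjExponent hp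
  have h := Real.young_inequality_of_nonneg
    (a := ε ^ ((p - 1) / p) * d) (b := (p / (p - 1) * (f / ε)) ^ ((p - 1) / p))
    (by positivity) (by positivity) hpq
  have e1 : (ε ^ ((p - 1) / p) * d) ^ p = ε ^ (p - 1) * d ^ p := by
    rw [Real.mul_rpow (by positivity) hd, ← Real.rpow_mul hε.le]
    congr 2; field_simp
  have e2 : ((p / (p - 1) * (f / ε)) ^ ((p - 1) / p)) ^ (p / (p - 1)) = p / (p - 1) * (f / ε) := by
    rw [← Real.rpow_mul (by positivity)]
    have : (p - 1) / p * (p / (p - 1)) = 1 := by field_simp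
    rw [this, Real.rpow_one]
  have e3 : p / (p - 1) * (f / ε) / (p / (p - 1)) = f / ε := by field_simp
  rw [e1, e2, e3] at h
  refine le_trans (le_of_eq ?_) h
  rw [Real.mul_rpow (by positivity) (by positivity), Real.div_rpow hf hε.le]
  have : ε ^ ((p - 1) / p) ≠ 0 := by positivity
  field_simp

theorem stmt1 (a b p θ ε : ℝ) (hab : a < b) (hp : 1 < p) (hθ : 1 < θ) (hε : 0 < ε)
    (u : ℝ → ℝ) (hu : ContDiffOn ℝ 1 u (Set.Icc a b))
    (hbc : (u a = -1 ∧ u b = 1) ∨ (u a = 1 ∧ u b = -1)) :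
    Eeps a b p θ ε u ≥ cp p θ := by
  have hp0 : 0 < p := by linarith
  have hp1 : 0 < p - 1 := by linarith
  set v := derivWithin u (Icc a b) with hv
  have hvc : ContinuousOn v (Icc a b) :=
    hu.continuousOn_derivWithin (uniqueDiffOn_Icc hab) le_rfl
  have huc := hu.continuousOn
  have hd : ∀ x ∈ Ioo a b, HasDerivAt u (v x) x := fun x hx =>
    ((hu.differentiableOn one_ne_zero x (Ioo_subset_Icc_self hx)).hasDerivWithinAt).hasDerivAt
      (Icc_mem_nhds hx.1 hx.2)
  set K := (p / (p - 1)) ^ ((p - 1) / p) with hK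
  have hK0 : 0 ≤ K := by positivity
  set G : ℝ → ℝ := fun s => (F θ s) ^ ((p - 1) / p) with hG
  have hG0 : ∀ s, 0 ≤ G s := fun s => Real.rpow_nonneg (F_nonneg' hθ s) _
  have hGc : Continuous G := (F_cont hθ).rpow_const (fun x => Or.inr (by positivity))
  have hE : Eeps a b p θ ε u
      = ∫ x in a..b, (ε ^ (p - 1) * |v x| ^ p / p + F θ (u x) / ε) := by
    unfold Eeps
    apply intervalIntegral.integral_congr_Ioo_of_le hab.le
    intro x hx
    simp only [(hd x hx).deriv]
  have hi1 : IntervalIntegrable (fun x => ε ^ (p - 1) * |v x| ^ p / p + F θ (u x) / ε)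
      volume a b := by
    apply ContinuousOn.intervalIntegrable_of_Icc hab.le
    refine ContinuousOn.add ?_ (((F_cont hθ).comp_continuousOn huc).div_const _)
    exact (continuousOn_const.mul (hvc.abs.rpow_const (fun x _ => Or.inr hp0.le))).div_const _
  have hgc : ContinuousOn (fun x => G (u x) * v x) (Icc a b) :=
    (hGc.comp_continuousOn huc).mul hvc
  have hsub : ∫ x in a..b, G (u x) * v x = ∫ s in u a..u b, G s := by
    rw [← uIcc_of_le hab.le] at huc hvc
    exact intervalIntegral.integral_comp_mul_deriv'' huc
      (fun x hx => by
        rw [min_eq_left hab.le, max_eq_right hab.le] at hx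
        exact (hd x hx).hasDerivWithinAt) hvc hGc.continuousOn
  have key : ∀ σ : ℝ, |σ| = 1 → σ * K * (∫ s in u a..u b, G s) ≤ Eeps a b p θ ε u := by
    intro σ hσ
    rw [hE, ← hsub, ← intervalIntegral.integral_const_mul]
    apply intervalIntegral.integral_mono_on hab.le _ hi1
    · intro x _
      refine le_trans ?_ (young_pt hp hε (F_nonneg' hθ (u x)) (abs_nonneg (v x)))
      have h1 : σ * v x ≤ |v x| := by
        have := le_abs_self (σ * v x)
        rwa [abs_mul, hσ, one_mul] at this
      calc σ * K * (G (u x) * v x) = K * (G (u x) * (σ * v x)) := by ring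
        _ ≤ K * (G (u x) * |v x|) := by
          have := hG0 (u x)
          gcongr
    · exact (continuousOn_const.mul hgc).intervalIntegrable_of_Icc hab.le
  have hc : cp p θ = K * ∫ s in (-1 : ℝ)..1, G s := rfl
  rw [ge_iff_le, hc]
  rcases hbc with ⟨h1, h2⟩ | ⟨h1, h2⟩
  · have := key 1 (by simp)
    rw [h1, h2] at this
    linarith
  · have := key (-1) (by simp)
    rw [h1, h2, intervalIntegral.integral_symm] at this
    linarith
end

section
/- Let 2 < p ≤ θ, ε > 0, and β ∈ (0, F'(u_−)), and set z_β^− := min{ z ∈ ℝ : G_β'(z) = 0 }. Then there exist ω_β > 0 and a pulse ψ_β : ℝ → ℝ solving ε^p(|ψ_β'|^{p−2}ψ_β')' = G_β'(ψ_β) on ℝ such that: ψ_β(0) = max_ℝ ψ_β =: z_β^+ with G_β(z_β^+) = G_β(z_β^−); ψ_β(x) = z_β^− for all x ∈ (−∞, −ω_β] ∪ [ω_β, +∞); ψ_β' > 0 on (−ω_β, 0) and ψ_β' < 0 on (0, ω_β). Moreover, lim_{β→0⁺} z_β^± = ±1. -/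
open Set MeasureTheory intervalIntegral Filter Topology

noncomputable def G (θ β u : ℝ) : ℝ := F θ u - β * u

noncomputable def uminus (θ : ℝ) : ℝ := -((2 * θ - 1) ^ (-(1 : ℝ) / 2))

noncomputable def uplus (θ : ℝ) : ℝ := (2 * θ - 1) ^ (-(1 : ℝ) / 2)


theorem glue_hasDerivAt {f g : ℝ → ℝ} {s : Set ℝ} (hs : s.Countable) (hf : Continuous f)
    (hg : Continuous g) (h : ∀ x, x ∉ s → HasDerivAt f (g x) x) (x : ℝ) :
    HasDerivAt f (g x) x := by
  have key : ∀ y, f y = f 0 + ∫ t in (0:ℝ)..y, g t := by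
    intro y
    rw [MeasureTheory.integral_eq_of_hasDerivAt_off_countable f g hs hf.continuousOn
      (fun z hz => h z hz.2) (hg.intervalIntegrable _ _)]
    ring
  have h2 : HasDerivAt (fun y => f 0 + ∫ t in (0:ℝ)..y, g t) (g x) x :=
    (intervalIntegral.integral_hasDerivAt_right (hg.intervalIntegrable _ _)
      (hg.stronglyMeasurableAtFilter _ _) hg.continuousAt).const_add _
  have : f = fun y => f 0 + ∫ t in (0:ℝ)..y, g t := funext key
  rw [this]; exact h2

theorem inv_exists {a b : ℝ} (hab : a < b) {S w : ℝ → ℝ} (hc : ContinuousOn S (Icc a b))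
    (hd : ∀ u ∈ Ioo a b, HasDerivAt S (w u) u) (hw : ∀ u ∈ Ioo a b, 0 < w u) (h0 : S a = 0) :
    0 < S b ∧ ∃ R : ℝ → ℝ, Continuous R ∧ R 0 = a ∧ R (S b) = b ∧ StrictMono R ∧
      ∀ y ∈ Ioo 0 (S b), HasDerivAt R (w (R y))⁻¹ y := by
  have hm : StrictMonoOn S (Icc a b) := by
    apply strictMonoOn_of_deriv_pos (convex_Icc a b) hc
    intro x hx
    rw [interior_Icc] at hx
    rw [(hd x hx).deriv]; exact hw x hx
  have hSb : 0 < S b := by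
    rw [← h0]; exact hm (left_mem_Icc.2 hab.le) (right_mem_Icc.2 hab.le) hab
  refine ⟨hSb, ?_⟩
  set c : ℝ → ℝ := fun u => max a (min b u) with hcdef
  have hcc : Continuous c := by fun_prop
  have hcm : ∀ u, c u ∈ Icc a b := fun u =>
    ⟨le_max_left _ _, max_le hab.le (min_le_left _ _)⟩
  have hcid : ∀ u ∈ Icc a b, c u = u := fun u hu => by
    simp [hcdef, hu.1, hu.2]
  set T : ℝ → ℝ := fun u => S (c u) + (u - c u) with hT
  have hTc : Continuous T := (hc.comp_continuous hcc hcm).add (continuous_id.sub hcc)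
  have hmono : Monotone c := by
    intro u v huv
    exact max_le_max le_rfl (min_le_min le_rfl huv)
  have hlip : ∀ u v, u ≤ v → u - c u ≤ v - c v := by
    intro u v huv
    simp only [hcdef]
    rcases max_cases a (min b u) with h | h <;> rcases max_cases a (min b v) with h' | h' <;>
    rcases min_cases b u with k | k <;> rcases min_cases b v with k' | k' <;> linarith
  have hTm : StrictMono T := by
    intro u v huv
    rcases (hmono huv.le).lt_or_eq with h | h
    · have := hm (hcm u) (hcm v) h
      have := hlip u v huv.le
      simp only [hT]; linarith
    · simp only [hT, h]; linarith
  have hS0 : ∀ u, 0 ≤ S (c u) ∧ S (c u) ≤ S b := fun u =>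
    ⟨by rw [← h0]; exact hm.monotoneOn (left_mem_Icc.2 hab.le) (hcm u) (hcm u).1,
      hm.monotoneOn (hcm u) (right_mem_Icc.2 hab.le) (hcm u).2⟩
  have hTs : Function.Surjective T := by
    apply hTc.surjective
    · apply tendsto_atTop_mono (f := fun u => -b + u) _ (tendsto_atTop_add_const_left _ _ tendsto_id)
      intro u
      have := (hS0 u).1; have := (hcm u).2
      simp only [hT]; linarith
    · refine tendsto_atBot_mono (f := fun u => (S b - a) + u) (g := T) ?_ (tendsto_atBot_add_const_left _ _ tendsto_id)
      intro u
      have := (hS0 u).2; have := (hcm u).1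
      simp only [hT]; linarith
  let e := hTm.orderIsoOfSurjective T hTs
  have he : ∀ y, T (e.symm y) = y := fun y => e.apply_symm_apply y
  have he' : ∀ u, e.symm (T u) = u := fun y => e.symm_apply_apply y
  have hTS : ∀ u ∈ Icc a b, T u = S u := fun u hu => by simp only [hT, hcid u hu]; ring
  have hTa : T a = 0 := by rw [hTS a (left_mem_Icc.2 hab.le), h0]
  have hTb : T b = S b := hTS b (right_mem_Icc.2 hab.le)
  have ea : e.symm 0 = a := by rw [← hTa, he']
  have eb : e.symm (S b) = b := by rw [← hTb, he']
  refine ⟨e.symm, e.symm.continuous, ea, eb, e.symm.strictMono, ?_⟩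
  intro y hy
  have hmem : e.symm y ∈ Ioo a b := by
    constructor
    · rw [← ea]; exact e.symm.strictMono hy.1
    · rw [← eb]; exact e.symm.strictMono hy.2
  apply HasDerivAt.of_local_left_inverse (f := T) e.symm.continuous.continuousAt _ (hw _ hmem).ne'
    (Eventually.of_forall he)
  apply (hd _ hmem).congr_of_eventuallyEq
  filter_upwards [isOpen_Ioo.mem_nhds hmem] with u hu
  exact hTS u (Ioo_subset_Icc_self hu)

theorem pulse_exists {p a b : ℝ} (hp : 1 < p) (hab : a < b) {H h : ℝ → ℝ}
    (hh : Continuous h) (hH : ∀ u, HasDerivAt H (h u) u) (ha : H a = 0) (hb : H b = 0)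
    (hha : h a = 0) (hpos : ∀ u ∈ Ioo a b, 0 < H u)
    (hint : IntervalIntegrable (fun u => (H u) ^ (-(1 / p))) volume a b) :
    ∃ ω > (0 : ℝ), ∃ ψ : ℝ → ℝ,
      (∀ x, deriv (fun y => |deriv ψ y| ^ (p - 2) * deriv ψ y) x = (p - 1) / p * h (ψ x)) ∧
      ψ 0 = b ∧ (∀ x, ψ x ≤ b) ∧ (∀ x ≤ -ω, ψ x = a) ∧ (∀ x ≥ ω, ψ x = a) ∧
      (∀ x ∈ Ioo (-ω) (0 : ℝ), 0 < deriv ψ x) ∧ (∀ x ∈ Ioo (0 : ℝ) ω, deriv ψ x < 0) := by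
  have hHc : Continuous H := continuous_iff_continuousAt.2 fun u => (hH u).continuousAt
  have hp0 : 0 < p := by linarith
  set w : ℝ → ℝ := fun u => (H u) ^ (-(1 / p)) with hwdef
  have hwpos : ∀ u ∈ Ioo a b, 0 < w u := fun u hu => Real.rpow_pos_of_pos (hpos u hu) _
  have hwc : ContinuousOn w (Ioo a b) := fun u hu =>
    (hHc.continuousAt.rpow_const (Or.inl (hpos u hu).ne')).continuousWithinAt
  obtain ⟨hω, R, hRc, hR0, hRω, hRm, hRd⟩ := inv_exists hab (S := fun u => ∫ t in a..u, w t) (w := w)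
    (by
      have := intervalIntegral.continuousOn_primitive_interval' hint (left_mem_uIcc)
      rwa [uIcc_of_le hab.le] at this)
    (by
      intro u hu
      apply intervalIntegral.integral_hasDerivAt_right
      · apply hint.mono_set
        rw [uIcc_of_le hab.le, uIcc_of_le hu.1.le]
        exact Icc_subset_Icc_right hu.2.le
      · exact hwc.stronglyMeasurableAtFilter isOpen_Ioo u hu
      · exact hwc.continuousAt (isOpen_Ioo.mem_nhds hu))
    hwpos (by simp)
  set ω := ∫ t in a..b, w t with hωdef
  change 0 < ω at hω
  change R ω = b at hRω
  change ∀ y ∈ Ioo 0 ω, HasDerivAt R (w (R y))⁻¹ y at hRd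
  set V : ℝ → ℝ := fun x => R (max 0 (ω - |x|)) with hV
  have hVc : Continuous V := by fun_prop
  have hVmem : ∀ x, V x ∈ Icc a b := by
    intro x
    constructor
    · rw [← hR0]; exact hRm.monotone (le_max_left _ _)
    · rw [← hRω]; exact hRm.monotone (max_le hω.le (by linarith [abs_nonneg x]))
  have hVI : ∀ x, x ≠ 0 → |x| < ω → V x ∈ Ioo a b := by
    intro x hx0 hx
    have : 0 < |x| := abs_pos.2 hx0
    constructor
    · rw [← hR0]; exact hRm (lt_max_of_lt_right (by linarith))
    · rw [← hRω]; exact hRm (max_lt hω (by linarith))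
  have hH0 : ∀ x, 0 ≤ H (V x) := by
    intro x
    rcases (hVmem x).1.eq_or_lt with h1 | h1
    · rw [← h1, ha]
    rcases (hVmem x).2.eq_or_lt with h2 | h2
    · rw [h2, hb]
    exact (hpos _ ⟨h1, h2⟩).le
  have hVa : ∀ x, ω ≤ |x| → V x = a := by
    intro x hx
    simp only [hV]; rw [max_eq_left (by linarith), hR0]
  have hV0 : V 0 = b := by
    simp only [hV]; rw [abs_zero, sub_zero, max_eq_right hω.le, hRω]
  -- the signed power of H along V
  let Q : ℝ → ℝ → ℝ := fun r x => if x ≤ 0 then (H (V x)) ^ r else - (H (V x)) ^ r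
  have hQc : ∀ r, 0 < r → Continuous (Q r) := by
    intro r hr
    apply Continuous.if_le
    · exact (hHc.comp hVc).rpow_const (fun x => Or.inr hr.le)
    · exact ((hHc.comp hVc).rpow_const (fun x => Or.inr hr.le)).neg
    · exact continuous_id
    · exact continuous_const
    · intro x hx
      subst hx
      rw [hV0, hb, Real.zero_rpow hr.ne']; simp
  have hpi : 0 < 1 / p := by positivity
  have hsc : ({0, ω, -ω} : Set ℝ).Countable := (Set.toFinite _).countable
  have hlocin : ∀ x, |x| < ω → x ≠ 0 → HasDerivAt V (Q (1 / p) x) x := by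
    intro x hx hx0
    have hxp : 0 < |x| := abs_pos.2 hx0
    have hm : ω - |x| ∈ Ioo 0 ω := ⟨by linarith, by linarith⟩
    have hVx : V x = R (ω - |x|) := by simp only [hV]; rw [max_eq_right hm.1.le]
    have hwi : (w (R (ω - |x|)))⁻¹ = H (V x) ^ (1 / p) := by
      rw [hVx.symm]; simp only [hwdef]
      rw [Real.rpow_neg (hH0 x), inv_inv]
    have hev : ∀ᶠ y in 𝓝 x, |y| < ω :=
      continuous_abs.continuousAt.eventually (gt_mem_nhds hx)
    rcases lt_or_gt_of_ne hx0 with h0 | h0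
    · have e1 : |x| = -x := abs_of_neg h0
      have hq : Q (1 / p) x = H (V x) ^ (1 / p) := if_pos h0.le
      have h1 : HasDerivAt (fun y => R (ω + y)) (H (V x) ^ (1 / p)) x := by
        have h2 := hRd _ hm
        rw [hwi] at h2
        have h3 : HasDerivAt (fun y : ℝ => ω + y) 1 x := (hasDerivAt_id x).const_add ω
        have e2 : ω - |x| = ω + x := by rw [e1]; ring
        rw [e2] at h2
        exact (HasDerivAt.comp x h2 h3).congr_deriv (by ring)
      rw [hq]
      apply h1.congr_of_eventuallyEq
      filter_upwards [hev, gt_mem_nhds h0] with y hy hy0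
      simp only [hV]
      rw [max_eq_right (by linarith), abs_of_neg hy0]; ring_nf
    · have e1 : |x| = x := abs_of_pos h0
      have hq : Q (1 / p) x = -H (V x) ^ (1 / p) := if_neg (not_le.2 h0)
      have h1 : HasDerivAt (fun y => R (ω - y)) (-H (V x) ^ (1 / p)) x := by
        have h2 := hRd _ hm
        rw [hwi] at h2
        have h3 : HasDerivAt (fun y : ℝ => ω - y) (-1) x := (hasDerivAt_id x).const_sub ω
        rw [e1] at h2
        exact (HasDerivAt.comp x h2 h3).congr_deriv (by ring)
      rw [hq]
      apply h1.congr_of_eventuallyEq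
      filter_upwards [hev, lt_mem_nhds h0] with y hy hy0
      simp only [hV]
      rw [max_eq_right (by linarith), abs_of_pos hy0]
  have hev_out : ∀ x, ω < |x| → ∀ᶠ y in 𝓝 x, V y = a := by
    intro x hx
    filter_upwards [continuous_abs.continuousAt.eventually (lt_mem_nhds hx)] with y hy
    exact hVa y hy.le
  have hQ0 : ∀ r, 0 < r → ∀ x, V x = a → Q r x = 0 := by
    intro r hr x hx
    simp only [Q, hx, ha, Real.zero_rpow hr.ne']; simp
  have hcases : ∀ x, x ∉ ({0, ω, -ω} : Set ℝ) → x ≠ 0 ∧ (|x| < ω ∨ ω < |x|) := by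
    intro x hx
    simp only [mem_insert_iff, mem_singleton_iff, not_or] at hx
    refine ⟨hx.1, lt_or_gt_of_ne fun h => ?_⟩
    rcases (abs_eq hω.le).1 h with h | h
    · exact hx.2.1 h
    · exact hx.2.2 h
  have hVd : ∀ x, HasDerivAt V (Q (1 / p) x) x := by
    apply glue_hasDerivAt hsc hVc (hQc _ hpi)
    intro x hx
    obtain ⟨hx0, h1 | h1⟩ := hcases x hx
    · exact hlocin x h1 hx0
    · rw [hQ0 _ hpi x (hVa x h1.le)]
      exact (hasDerivAt_const x a).congr_of_eventuallyEq (hev_out x h1)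
  have hdV : deriv V = Q (1 / p) := funext fun x => (hVd x).deriv
  have hpow : ∀ t : ℝ, 0 ≤ t → (t ^ (1 / p)) ^ (p - 2) * t ^ (1 / p) = t ^ ((p - 1) / p) := by
    intro t ht
    rcases ht.eq_or_lt with h0 | h0
    · rw [← h0, Real.zero_rpow hpi.ne', mul_zero, Real.zero_rpow]
      have : 0 < (p - 1) / p := div_pos (by linarith) hp0
      exact this.ne'
    · rw [← Real.rpow_mul ht, ← Real.rpow_add h0]
      congr 1; field_simp; ring
  have hfl : (fun y => |deriv V y| ^ (p - 2) * deriv V y) = Q ((p - 1) / p) := by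
    funext x
    rw [hdV]
    have hn := Real.rpow_nonneg (hH0 x) (1 / p)
    by_cases hx : x ≤ 0
    · simp only [Q, if_pos hx]
      rw [abs_of_nonneg hn, hpow _ (hH0 x)]
    · simp only [Q, if_neg hx]
      rw [abs_neg, abs_of_nonneg hn, mul_neg, hpow _ (hH0 x)]
  have hr : 0 < (p - 1) / p := div_pos (by linarith) hp0
  have hQd : ∀ x, HasDerivAt (Q ((p - 1) / p)) ((p - 1) / p * h (V x)) x := by
    apply glue_hasDerivAt hsc (hQc _ hr) (by fun_prop)
    intro x hx
    obtain ⟨hx0, h1 | h1⟩ := hcases x hx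
    · have hP := hpos _ (hVI x hx0 h1)
      have h2 : HasDerivAt (fun y => H (V y)) (h (V x) * Q (1 / p) x) x :=
        HasDerivAt.comp x (hH (V x)) (hVd x)
      have h3 := h2.rpow_const (p := (p - 1) / p) (Or.inl hP.ne')
      have hcancel : H (V x) ^ (1 / p) * H (V x) ^ ((p - 1) / p - 1) = 1 := by
        rw [← Real.rpow_add hP]
        have : 1 / p + ((p - 1) / p - 1) = 0 := by field_simp; ring
        rw [this, Real.rpow_zero]
      rcases lt_or_gt_of_ne hx0 with h0 | h0
      · have hq : Q (1 / p) x = H (V x) ^ (1 / p) := if_pos h0.le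
        have h4 : HasDerivAt (fun y => H (V y) ^ ((p - 1) / p)) ((p - 1) / p * h (V x)) x := by
          refine h3.congr_deriv ?_
          rw [hq]
          linear_combination (((p - 1) / p * h (V x))) * hcancel
        apply h4.congr_of_eventuallyEq
        filter_upwards [gt_mem_nhds h0] with y hy
        exact if_pos (le_of_lt hy)
      · have hq : Q (1 / p) x = -H (V x) ^ (1 / p) := if_neg (not_le.2 h0)
        have h4 : HasDerivAt (fun y => -H (V y) ^ ((p - 1) / p)) ((p - 1) / p * h (V x)) x := by
          refine h3.neg.congr_deriv ?_
          rw [hq]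
          linear_combination (((p - 1) / p * h (V x))) * hcancel
        apply h4.congr_of_eventuallyEq
        filter_upwards [lt_mem_nhds h0] with y hy
        exact if_neg (not_le.2 hy)
    · rw [hVa x h1.le, hha, mul_zero]
      apply (hasDerivAt_const x (0:ℝ)).congr_of_eventuallyEq
      filter_upwards [hev_out x h1] with y hy
      exact hQ0 _ hr y hy
  refine ⟨ω, hω, V, ?_, hV0, fun x => (hVmem x).2, ?_, ?_, ?_, ?_⟩
  · intro x
    rw [hfl]; exact (hQd x).deriv
  · intro x hx
    exact hVa x (by rw [abs_of_nonpos (by linarith)]; linarith)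
  · intro x hx
    exact hVa x (by rw [abs_of_nonneg (by linarith)]; linarith)
  · intro x hx
    have hP := hpos _ (hVI x hx.2.ne (by rw [abs_of_neg hx.2]; linarith [hx.1]))
    rw [hdV]
    simp only [Q, if_pos hx.2.le]
    exact Real.rpow_pos_of_pos hP _
  · intro x hx
    have hP := hpos _ (hVI x hx.1.ne' (by rw [abs_of_pos hx.1]; exact hx.2))
    rw [hdV]
    simp only [Q, if_neg (not_le.2 hx.1)]
    exact neg_neg_of_pos (Real.rpow_pos_of_pos hP _)

theorem integrable_sing {p a b : ℝ} (hp : 2 < p) (hab : a < b) {H h : ℝ → ℝ}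
    (hH : ∀ u, HasDerivAt H (h u) u) (ha : H a = 0) (hb : H b = 0)
    (hha : h a = 0) (hpos : ∀ u ∈ Ioo a b, 0 < H u) {k : ℝ} (hk : 0 < k)
    (hd : HasDerivAt h k a) (hhb : h b < 0) :
    IntervalIntegrable (fun u => (H u) ^ (-(1 / p))) volume a b := by
  have hHc : Continuous H := continuous_iff_continuousAt.2 fun u => (hH u).continuousAt
  have hp0 : 0 < p := by linarith
  have hmeas : Measurable (fun u => (H u) ^ (-(1 / p))) := hHc.measurable.pow_const _
  -- near a
  obtain ⟨c, hc, hcb⟩ : ∃ c, a < c ∧ ∀ u ∈ Ioo a c, k / 2 * (u - a) ≤ h u := by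
    have h1 := (hasDerivAt_iff_tendsto_slope.1 hd).eventually (lt_mem_nhds (half_lt_self hk))
    have h2 : ∀ᶠ u in 𝓝[>] a, k / 2 < slope h a u :=
      h1.filter_mono (nhdsWithin_mono _ fun u hu => ne_of_gt hu)
    obtain ⟨c, hc, hcs⟩ := (mem_nhdsGT_iff_exists_Ioo_subset).1 h2
    refine ⟨c, hc, fun u hu => ?_⟩
    have h3 : k / 2 < slope h a u := hcs hu
    rw [slope_def_field, hha, sub_zero, lt_div_iff₀ (by linarith [hu.1])] at h3
    exact h3.le
  have hlow : ∀ u ∈ Icc a c, k / 4 * (u - a) ^ 2 ≤ H u := by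
    have hm : MonotoneOn (fun u => H u - k / 4 * (u - a) ^ 2) (Icc a c) := by
      have hdd : ∀ x, HasDerivAt (fun u => H u - k / 4 * (u - a) ^ 2) (h x - k / 2 * (x - a)) x := by
        intro x
        have h1 : HasDerivAt (fun u : ℝ => u - a) 1 x := (hasDerivAt_id x).sub_const a
        refine ((hH x).sub ((h1.pow 2).const_mul (k / 4))).congr_deriv ?_
        norm_num; ring
      apply monotoneOn_of_deriv_nonneg (convex_Icc a c)
      · exact fun x _ => (hdd x).continuousAt.continuousWithinAt
      · exact fun x _ => (hdd x).differentiableAt.differentiableWithinAt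
      · intro x hx
        rw [interior_Icc] at hx
        rw [(hdd x).deriv]
        linarith [hcb x hx]
    intro u hu
    have := hm (left_mem_Icc.2 hc.le) hu hu.1
    simp only [ha, sub_self] at this
    norm_num at this
    linarith
  obtain ⟨d, hdb, hdl⟩ : ∃ d, d < b ∧ ∀ u ∈ Ioo d b, (-h b / 2) * (b - u) ≤ H u := by
    have h1 := (hasDerivAt_iff_tendsto_slope.1 (hH b)).eventually
      (gt_mem_nhds (show h b < h b / 2 by linarith))
    have h2 : ∀ᶠ u in 𝓝[<] b, slope H b u < h b / 2 :=
      h1.filter_mono (nhdsWithin_mono _ fun u hu => ne_of_lt hu)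
    obtain ⟨c, hc, hcs⟩ := (mem_nhdsLT_iff_exists_Ioo_subset).1 h2
    refine ⟨c, hc, fun u hu => ?_⟩
    have h3 : slope H b u < h b / 2 := hcs hu
    rw [slope_def_field, hb, sub_zero, div_lt_iff_of_neg (by linarith [hu.2])] at h3
    nlinarith
  set m := (a + b) / 2 with hmdef
  have hI1 : IntervalIntegrable (fun u => (H u) ^ (-(1 / p))) volume a (min c m) := by
    have hlt : a < min c m := lt_min hc (by linarith)
    have h1 : IntervalIntegrable (fun u => (k / 4) ^ (-(1 / p)) * (u - a) ^ (-(2 / p))) volume a (min c m) := by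
      apply IntervalIntegrable.const_mul
      have := (intervalIntegral.intervalIntegrable_rpow' (a := 0) (b := min c m - a)
        (r := -(2 / p)) (by rw [neg_lt_neg_iff, div_lt_one hp0]; exact hp)).comp_sub_right a
      simpa using this
    apply h1.mono_fun' hmeas.aestronglyMeasurable
    rw [uIoc_of_le hlt.le]
    filter_upwards [ae_restrict_mem measurableSet_Ioc] with u hu
    have hua : 0 < u - a := by linarith [hu.1]
    have h2 := hlow u ⟨hu.1.le, hu.2.trans (min_le_left _ _)⟩
    have h3 : 0 < k / 4 * (u - a) ^ 2 := by positivity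
    rw [Real.norm_of_nonneg (Real.rpow_nonneg (h3.le.trans h2) _)]
    have h4 := Real.rpow_le_rpow_of_nonpos h3 h2 (z := -(1 / p)) (by
      rw [neg_nonpos]; positivity)
    refine h4.trans (le_of_eq ?_)
    rw [Real.mul_rpow (by positivity) (by positivity), ← Real.rpow_natCast, ← Real.rpow_mul hua.le]
    congr 2; push_cast; ring
  have hI3 : IntervalIntegrable (fun u => (H u) ^ (-(1 / p))) volume (max d m) b := by
    have hlt : max d m < b := max_lt hdb (by linarith)
    have h1 : IntervalIntegrable (fun u => (-h b / 2) ^ (-(1 / p)) * (b - u) ^ (-(1 / p))) volume (max d m) b := by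
      apply IntervalIntegrable.const_mul
      have := (intervalIntegral.intervalIntegrable_rpow' (a := b - max d m) (b := 0)
        (r := -(1 / p)) (by rw [neg_lt_neg_iff, div_lt_one hp0]; linarith)).comp_sub_left b
      simpa using this
    apply h1.mono_fun' hmeas.aestronglyMeasurable
    rw [uIoc_of_le hlt.le, ← restrict_Ioo_eq_restrict_Ioc]
    filter_upwards [ae_restrict_mem measurableSet_Ioo] with u hu
    have hua : 0 < b - u := by linarith [hu.2]
    have h2 := hdl u ⟨(le_max_left _ _).trans_lt hu.1, hu.2⟩
    have hnb : 0 < -h b / 2 := by linarith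
    have h3 : 0 < -h b / 2 * (b - u) := by positivity
    rw [Real.norm_of_nonneg (Real.rpow_nonneg (h3.le.trans h2) _)]
    have h4 := Real.rpow_le_rpow_of_nonpos h3 h2 (z := -(1 / p)) (by
      rw [neg_nonpos]; positivity)
    refine h4.trans (le_of_eq ?_)
    rw [Real.mul_rpow (by positivity) (by positivity)]
  have hI2 : IntervalIntegrable (fun u => (H u) ^ (-(1 / p))) volume (min c m) (max d m) := by
    apply ContinuousOn.intervalIntegrable
    intro u hu
    rw [uIcc_of_le ((min_le_right _ _).trans (le_max_right _ _))] at hu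
    have h1 : u ∈ Ioo a b :=
      ⟨(lt_min hc (by linarith)).trans_le hu.1, hu.2.trans_lt (max_lt hdb (by linarith))⟩
    exact (hHc.continuousAt.rpow_const (Or.inl (hpos u h1).ne')).continuousWithinAt
  exact (hI1.trans hI2).trans hI3

theorem F_hasDerivAt {θ : ℝ} (hθ : 2 < θ) (u : ℝ) : HasDerivAt (F θ) (F' θ u) u := by
  have h1 : HasDerivAt (fun x : ℝ => 1 - x ^ 2) (-(2 * u)) u := by
    refine ((hasDerivAt_pow 2 u).const_sub 1).congr_deriv ?_
    norm_num
  have h2 := (HasDerivAt.comp u (hasDerivAt_abs_rpow (1 - u ^ 2) (p := θ) (by linarith)) h1).const_mul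
    (1 / (2 * θ))
  refine h2.congr_deriv ?_
  unfold F'
  field_simp

theorem F'_cont {θ : ℝ} (hθ : 2 < θ) : Continuous (F' θ) := by
  unfold F'
  have : Continuous fun u : ℝ => |1 - u ^ 2| ^ (θ - 2) :=
    (by fun_prop : Continuous fun u : ℝ => |1 - u ^ 2|).rpow_const (fun x => Or.inr (by linarith))
  fun_prop

theorem F'_hasDerivAt {θ : ℝ} (hθ : 2 < θ) {u : ℝ} (hu : u ∈ Ioo (-1 : ℝ) 1) :
    HasDerivAt (F' θ) ((1 - u ^ 2) ^ (θ - 2) * ((2 * θ - 1) * u ^ 2 - 1)) u := by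
  have hpos : ∀ v ∈ Ioo (-1 : ℝ) 1, 0 < 1 - v ^ 2 := fun v hv => by nlinarith [hv.1, hv.2]
  have h1 : HasDerivAt (fun x : ℝ => 1 - x ^ 2) (-(2 * u)) u := by
    refine ((hasDerivAt_pow 2 u).const_sub 1).congr_deriv ?_
    norm_num
  have h2 := (hasDerivAt_neg u).mul (h1.rpow_const (p := θ - 1) (Or.inr (by linarith)))
  have h3 : HasDerivAt (fun x : ℝ => -x * (1 - x ^ 2) ^ (θ - 1))
      ((1 - u ^ 2) ^ (θ - 2) * ((2 * θ - 1) * u ^ 2 - 1)) u := by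
    refine h2.congr_deriv ?_
    have e1 : (1 - u ^ 2) ^ (θ - 1) = (1 - u ^ 2) ^ (θ - 2) * (1 - u ^ 2) := by
      rw [← Real.rpow_add_one (hpos u hu).ne']; congr 1; ring
    have e2 : θ - 1 - 1 = θ - 2 := by ring
    rw [e2, e1]; ring
  apply h3.congr_of_eventuallyEq
  filter_upwards [isOpen_Ioo.mem_nhds hu] with v hv
  have e1 : (1 - v ^ 2) ^ (θ - 1) = (1 - v ^ 2) ^ (θ - 2) * (1 - v ^ 2) := by
    rw [← Real.rpow_add_one (hpos v hv).ne']; congr 1; ring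
  unfold F'
  rw [abs_of_pos (hpos v hv), e1]; ring

theorem uminus_sq {θ : ℝ} (hθ : 2 < θ) : (2 * θ - 1) * uminus θ ^ 2 = 1 := by
  unfold uminus
  have h : 0 < 2 * θ - 1 := by linarith
  rw [neg_sq, ← Real.rpow_natCast, ← Real.rpow_mul h.le]
  norm_num
  rw [Real.rpow_neg_one]; field_simp

theorem uminus_mem {θ : ℝ} (hθ : 2 < θ) : uminus θ ∈ Ioo (-1 : ℝ) 0 := by
  have h := uminus_sq hθ
  have h0 : uminus θ < 0 := by
    unfold uminus
    have : 0 < (2 * θ - 1) ^ (-(1 : ℝ) / 2) := Real.rpow_pos_of_pos (by linarith) _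
    linarith
  refine ⟨?_, h0⟩
  by_contra hc
  push Not at hc
  nlinarith

theorem F'_mono {θ : ℝ} (hθ : 2 < θ) : StrictMonoOn (F' θ) (Icc (-1) (uminus θ)) := by
  have hu := uminus_mem hθ
  apply strictMonoOn_of_deriv_pos (convex_Icc _ _) (F'_cont hθ).continuousOn
  intro x hx
  rw [interior_Icc] at hx
  rw [(F'_hasDerivAt hθ ⟨hx.1, by linarith [hx.2, hu.2]⟩).deriv]
  have h1 : 0 < 1 - x ^ 2 := by nlinarith [hx.1, hx.2, hu.2]
  have h2 := uminus_sq hθ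
  apply mul_pos (Real.rpow_pos_of_pos h1 _)
  have : uminus θ ^ 2 < x ^ 2 := by nlinarith [hx.2, hu.2]
  nlinarith

theorem F'_anti {θ : ℝ} (hθ : 2 < θ) : StrictAntiOn (F' θ) (Icc (uminus θ) 0) := by
  have hu := uminus_mem hθ
  apply strictAntiOn_of_deriv_neg (convex_Icc _ _) (F'_cont hθ).continuousOn
  intro x hx
  rw [interior_Icc] at hx
  rw [(F'_hasDerivAt hθ ⟨by linarith [hx.1, hu.1], by linarith [hx.2]⟩).deriv]
  have h1 : 0 < 1 - x ^ 2 := by nlinarith [hx.1, hx.2, hu.1]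
  have h2 := uminus_sq hθ
  apply mul_neg_of_pos_of_neg (Real.rpow_pos_of_pos h1 _)
  have : x ^ 2 < uminus θ ^ 2 := by nlinarith [hx.1, hx.2]
  nlinarith

theorem F'_nonpos {θ u : ℝ} (h : 0 ≤ u * (1 - u ^ 2)) : F' θ u ≤ 0 := by
  unfold F'
  have := Real.rpow_nonneg (abs_nonneg (1 - u ^ 2)) (θ - 2)
  nlinarith

theorem G_hasDerivAt {θ : ℝ} (hθ : 2 < θ) (β u : ℝ) : HasDerivAt (G θ β) (F' θ u - β) u := by
  have := (F_hasDerivAt hθ u).sub ((hasDerivAt_id u).const_mul β)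
  exact this.congr_deriv (by ring)

theorem G_cont {θ : ℝ} (hθ : 2 < θ) (β : ℝ) : Continuous (G θ β) :=
  continuous_iff_continuousAt.2 fun u => (G_hasDerivAt hθ β u).continuousAt

theorem G_mono {θ : ℝ} (hθ : 2 < θ) (β : ℝ) {a b : ℝ} (h : ∀ u ∈ Ioo a b, β < F' θ u) :
    StrictMonoOn (G θ β) (Icc a b) := by
  apply strictMonoOn_of_deriv_pos (convex_Icc _ _) (G_cont hθ β).continuousOn
  intro x hx
  rw [interior_Icc] at hx
  rw [(G_hasDerivAt hθ β x).deriv]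
  linarith [h x hx]

theorem G_anti {θ : ℝ} (hθ : 2 < θ) (β : ℝ) {a b : ℝ} (h : ∀ u ∈ Ioo a b, F' θ u < β) :
    StrictAntiOn (G θ β) (Icc a b) := by
  apply strictAntiOn_of_deriv_neg (convex_Icc _ _) (G_cont hθ β).continuousOn
  intro x hx
  rw [interior_Icc] at hx
  rw [(G_hasDerivAt hθ β x).deriv]
  linarith [h x hx]

theorem G_one {θ : ℝ} (hθ : 2 < θ) (β : ℝ) : G θ β 1 = -β := by
  unfold G F
  norm_num
  right; exact Real.zero_rpow (by linarith)

theorem G_neg_one {θ : ℝ} (hθ : 2 < θ) (β : ℝ) : G θ β (-1) = β := by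
  unfold G F
  norm_num
  right; exact Real.zero_rpow (by linarith)

theorem potential_shape {θ : ℝ} (hθ : 2 < θ) {β : ℝ} (hβ : β ∈ Ioo (0 : ℝ) (F' θ (uminus θ)))
    {zm : ℝ} (hz : IsLeast {z : ℝ | F' θ z - β = 0} zm) :
    zm ∈ Ioo (-1) (uminus θ) ∧ F' θ zm = β ∧ ∃ z2 ∈ Ioo (uminus θ) 0,
      StrictAntiOn (G θ β) (Icc (-1) zm) ∧ StrictMonoOn (G θ β) (Icc zm z2) ∧
      StrictAntiOn (G θ β) (Icc z2 1) ∧ (∀ u ∈ Ioo zm z2, β < F' θ u) ∧ F' θ z2 = β ∧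
      (∀ u ∈ Ioc z2 1, F' θ u < β) ∧ G θ β 1 < G θ β zm := by
  have hu := uminus_mem hθ
  have hzm : F' θ zm = β := by have := hz.1; simp only [mem_ofPred_eq] at this; linarith
  have hF1 : F' θ (-1) = 0 := by simp [F']
  have hF0 : F' θ 0 = 0 := by simp [F']
  obtain ⟨z1, hz1, hz1e⟩ := intermediate_value_Ioo hu.1.le (F'_cont hθ).continuousOn
    (show β ∈ Ioo (F' θ (-1)) (F' θ (uminus θ)) by rw [hF1]; exact hβ)
  obtain ⟨z2, hz2, hz2e⟩ := intermediate_value_Ioo' hu.2.le (F'_cont hθ).continuousOn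
    (show β ∈ Ioo (F' θ 0) (F' θ (uminus θ)) by rw [hF0]; exact hβ)
  have hle : zm ≤ z1 := hz.2 (by simp [hz1e])
  have hzmI : zm ∈ Ioo (-1) (uminus θ) := by
    refine ⟨?_, hle.trans_lt hz1.2⟩
    by_contra hc
    push Not at hc
    have : F' θ zm ≤ 0 := F'_nonpos (by nlinarith [mul_nonneg (by linarith : 0 ≤ -zm) (by nlinarith : 0 ≤ zm ^ 2 - 1)])
    linarith [hβ.1]
  have A1 : ∀ u ∈ Ioo (-1) zm, F' θ u < β := fun u hu' => by
    rw [← hzm]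
    exact F'_mono hθ ⟨hu'.1.le, by linarith [hu'.2, hzmI.2]⟩ ⟨hzmI.1.le, hzmI.2.le⟩ hu'.2
  have A2 : ∀ u ∈ Ioo zm z2, β < F' θ u := fun u hu' => by
    rcases le_total u (uminus θ) with h | h
    · rw [← hzm]
      exact F'_mono hθ ⟨hzmI.1.le, hzmI.2.le⟩ ⟨by linarith [hu'.1, hzmI.1], h⟩ hu'.1
    · rw [← hz2e]
      exact F'_anti hθ ⟨h, by linarith [hu'.2, hz2.2]⟩ ⟨hz2.1.le, hz2.2.le⟩ hu'.2
  have A3 : ∀ u ∈ Ioc z2 1, F' θ u < β := fun u hu' => by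
    rcases le_total u 0 with h | h
    · rw [← hz2e]
      exact F'_anti hθ ⟨hz2.1.le, hz2.2.le⟩ ⟨by linarith [hu'.1, hz2.1], h⟩ hu'.1
    · have : F' θ u ≤ 0 := F'_nonpos (mul_nonneg h (by nlinarith [hu'.2]))
      linarith [hβ.1]
  refine ⟨hzmI, hzm, z2, hz2, G_anti hθ β A1, G_mono hθ β A2,
    G_anti hθ β (fun u h => A3 u ⟨h.1, h.2.le⟩), A2, hz2e, A3, ?_⟩
  rw [G_one hθ]
  have : 0 ≤ F θ zm := by
    unfold F
    have : 0 < 1 / (2 * θ) := by positivity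
    positivity
  unfold G
  nlinarith [hβ.1, hzmI.2, hu.2]

theorem stmt3 (p θ ε : ℝ) (hp : 2 < p) (hpθ : p ≤ θ) (hε : 0 < ε) :
    (∀ β ∈ Set.Ioo (0 : ℝ) (F' θ (uminus θ)), ∀ zm : ℝ,
      IsLeast {z : ℝ | F' θ z - β = 0} zm →
      ∃ ω > (0 : ℝ), ∃ ψ : ℝ → ℝ, ∃ zp : ℝ,
        (∀ x : ℝ,
          ε ^ p * deriv (fun y => |deriv ψ y| ^ (p - 2) * deriv ψ y) x = F' θ (ψ x) - β) ∧
        ψ 0 = zp ∧ (∀ x, ψ x ≤ zp) ∧ G θ β zp = G θ β zm ∧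
        (∀ x ≤ -ω, ψ x = zm) ∧ (∀ x ≥ ω, ψ x = zm) ∧
        (∀ x ∈ Set.Ioo (-ω) (0 : ℝ), 0 < deriv ψ x) ∧
        (∀ x ∈ Set.Ioo (0 : ℝ) ω, deriv ψ x < 0)) ∧
    (∀ δ > (0 : ℝ), ∃ β₀ > (0 : ℝ), ∀ β ∈ Set.Ioo (0 : ℝ) (min β₀ (F' θ (uminus θ))),
      ∀ zm zp : ℝ, IsLeast {z : ℝ | F' θ z - β = 0} zm →
        (zm < zp ∧ G θ β zp = G θ β zm ∧ F' θ zp - β < 0) →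
        |zm + 1| < δ ∧ |zp - 1| < δ) := by
  have hθ : 2 < θ := by linarith
  have hu := uminus_mem hθ
  refine ⟨?_, ?_⟩
  · intro β hβ zm hz
    obtain ⟨hzm, hzme, z2, hz2, -, hm, ha, A2, hz2e, A3, hlt⟩ := potential_shape hθ hβ hz
    have hzz : zm < z2 := hzm.2.trans hz2.1
    have hz21 : z2 < 1 := by linarith [hz2.2]
    have hG2 : G θ β zm < G θ β z2 := hm (left_mem_Icc.2 hzz.le) (right_mem_Icc.2 hzz.le) hzz
    obtain ⟨zp, hzp, hzpe⟩ := intermediate_value_Ioo' hz21.le (G_cont hθ β).continuousOn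
      (show G θ β zm ∈ Ioo (G θ β 1) (G θ β z2) from ⟨hlt, hG2⟩)
    have hpos : ∀ u ∈ Ioo zm zp, 0 < G θ β u - G θ β zm := by
      intro u hu'
      rcases le_total u z2 with h | h
      · have := hm (left_mem_Icc.2 hzz.le) ⟨hu'.1.le, h⟩ hu'.1
        linarith
      · have := ha ⟨h, by linarith [hu'.2, hzp.2]⟩ ⟨hzp.1.le, hzp.2.le⟩ hu'.2
        linarith
    have hεp : 0 < ε ^ p := Real.rpow_pos_of_pos hε p
    have hp1 : 0 < p - 1 := by linarith
    set C : ℝ := p / ((p - 1) * ε ^ p) with hC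
    have hCpos : 0 < C := by positivity
    have hH : ∀ u, HasDerivAt (fun u => C * (G θ β u - G θ β zm)) (C * (F' θ u - β)) u :=
      fun u => ((G_hasDerivAt hθ β u).sub_const _).const_mul C
    have hzmzp : zm < zp := hzz.trans hzp.1
    have hk : 0 < C * ((1 - zm ^ 2) ^ (θ - 2) * ((2 * θ - 1) * zm ^ 2 - 1)) := by
      have h1 : 0 < 1 - zm ^ 2 := by nlinarith [hzm.1, hzm.2, hu.2]
      have h2 := uminus_sq hθ
      have : uminus θ ^ 2 < zm ^ 2 := by nlinarith [hzm.2, hu.2]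
      exact mul_pos hCpos (mul_pos (Real.rpow_pos_of_pos h1 _) (by nlinarith))
    have hd : HasDerivAt (fun u => C * (F' θ u - β))
        (C * ((1 - zm ^ 2) ^ (θ - 2) * ((2 * θ - 1) * zm ^ 2 - 1))) zm :=
      ((F'_hasDerivAt hθ ⟨hzm.1, by linarith [hzm.2, hu.2]⟩).sub_const β).const_mul C
    have hpos' : ∀ u ∈ Ioo zm zp, 0 < C * (G θ β u - G θ β zm) :=
      fun u hu' => mul_pos hCpos (hpos u hu')
    have hint := integrable_sing hp hzmzp hH (by simp) (by simp [hzpe]) (by simp [hzme]) hpos' hk hd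
      (mul_neg_of_pos_of_neg hCpos (by linarith [A3 zp ⟨hzp.1, hzp.2.le⟩]))
    obtain ⟨ω, hω, ψ, h1, h2, h3, h4, h5, h6, h7⟩ := pulse_exists (p := p) (by linarith) hzmzp
      (((F'_cont hθ).sub continuous_const).const_mul C) hH (by simp) (by simp [hzpe])
      (by simp [hzme]) hpos' hint
    refine ⟨ω, hω, ψ, zp, ?_, h2, h3, hzpe, h4, h5, h6, h7⟩
    intro x
    rw [h1 x, hC]
    field_simp
    rfl
  · intro δ hδ
    set d := min δ (1 / 2) with hd
    have hd0 : 0 < d := lt_min hδ (by norm_num)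
    have hdδ : d ≤ δ := min_le_left _ _
    have hd2 : d ≤ 1 / 2 := min_le_right _ _
    set v := min (-1 + d) (uminus θ) with hv
    have hv1 : -1 < v := lt_min (by linarith) hu.1
    have hv2 : v ≤ uminus θ := min_le_right _ _
    have hv3 : v ≤ -1 + d := min_le_left _ _
    have hF1 : F' θ (-1) = 0 := by simp [F']
    have hFv : 0 < F' θ v := by
      rw [← hF1]
      exact F'_mono hθ ⟨le_rfl, hu.1.le⟩ ⟨hv1.le, hv2⟩ hv1
    have hFd : 0 < F θ (1 - d) := by
      unfold F
      have : 0 < 1 - (1 - d) ^ 2 := by nlinarith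
      have h2 := Real.rpow_pos_of_pos (abs_pos.2 this.ne') θ
      have : 0 < 1 / (2 * θ) := by positivity
      positivity
    refine ⟨min (F' θ v) (F θ (1 - d) / 2), lt_min hFv (by linarith), ?_⟩
    rintro β ⟨hβ0, hβ⟩ zm zp hz ⟨hlt, hGe, hFp⟩
    have hβu : β < F' θ (uminus θ) := hβ.trans_le (min_le_right _ _)
    have hβv : β < F' θ v := hβ.trans_le ((min_le_left _ _).trans (min_le_left _ _))
    have hβd : β < F θ (1 - d) / 2 := hβ.trans_le ((min_le_left _ _).trans (min_le_right _ _))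
    obtain ⟨hzm, hzme, z2, hz2, ha0, hm, ha, A2, hz2e, A3, hG1⟩ := potential_shape hθ ⟨hβ0, hβu⟩ hz
    have hzmv : zm < v := by
      by_contra hc
      push Not at hc
      have := (F'_mono hθ).monotoneOn ⟨hv1.le, hv2⟩ ⟨hzm.1.le, hzm.2.le⟩ hc
      linarith
    have hzp2 : z2 < zp := by
      by_contra hc
      push Not at hc
      rcases hc.lt_or_eq with h | h
      · linarith [A2 zp ⟨hlt, h⟩]
      · rw [h, hz2e] at hFp; linarith
    have hzp1 : zp < 1 := by
      by_contra hc
      push Not at hc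
      have hF : ∀ u ∈ Ioo 1 zp, F' θ u < β := by
        intro u hu'
        have hu2 : 0 < u ^ 2 - 1 := by nlinarith [hu'.1]
        have hz2' : u ^ 2 - 1 ≤ zp ^ 2 - 1 := by nlinarith [hu'.1, hu'.2]
        have : F' θ u ≤ F' θ zp := by
          have e : ∀ t, 0 < t ^ 2 - 1 → F' θ t = t * (t ^ 2 - 1) * (t ^ 2 - 1) ^ (θ - 2) := by
            intro t ht
            unfold F'
            rw [abs_sub_comm, abs_of_pos ht]; ring
          rw [e u hu2, e zp (by linarith)]
          have h1 : u ≤ zp := hu'.2.le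
          have h0 : 0 < u := by linarith [hu'.1]
          have h00 : 0 ≤ zp := by linarith
          have h3 : 0 ≤ zp ^ 2 - 1 := by linarith
          have h2 := Real.rpow_le_rpow hu2.le hz2' (by linarith : 0 ≤ θ - 2)
          have h4 := Real.rpow_nonneg hu2.le (θ - 2)
          exact mul_le_mul (mul_le_mul h1 hz2' hu2.le h00) h2 h4 (mul_nonneg h00 h3)
        linarith
      have := (G_anti hθ β hF).antitoneOn (left_mem_Icc.2 hc) (right_mem_Icc.2 hc) hc
      linarith
    have hzpd : 1 - d < zp := by
      by_contra hc
      push Not at hc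
      have h1 := ha.antitoneOn ⟨hzp2.le, hzp1.le⟩ ⟨by linarith [hz2.2], by linarith⟩ hc
      have h2 := ha0.antitoneOn ⟨le_rfl, hzm.1.le⟩ ⟨hzm.1.le, le_rfl⟩ hzm.1.le
      rw [G_neg_one hθ] at h2
      have h3 : F θ (1 - d) - β * (1 - d) ≤ β := by
        have : G θ β (1 - d) = F θ (1 - d) - β * (1 - d) := rfl
        linarith
      nlinarith
    constructor
    · rw [abs_lt]; constructor <;> linarith [hzm.1]
    · rw [abs_lt]; constructor <;> linarith
end

section
/- Fix a piecewise constant function v as above, let h_i be one of its jump points with v ≡ −1 on (h_i − r, h_i) and v ≡ +1 on (h_i, h_i + r), and fix r̂ ∈ (0, r) and ρ > 0. Then there exists δ > 0 such that every continuous function u ∈ H¹(a,b) with ‖ũ − ṽ‖_{L¹(a,b)} ≤ δ admits r_+ ∈ (0, r̂) and r_− ∈ (0, r̂) with |u(h_i + r_+) − 1| < ρ and |u(h_i − r_−) + 1| < ρ. -/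
open Set MeasureTheory intervalIntegral Filter Topology

/-- `u` belongs to the Sobolev space `H¹(a,b)`: it is (absolutely) continuous on `[a,b]`,
it is recovered from its derivative by the fundamental theorem of calculus, and its
derivative is square integrable. -/
def MemH1 (a b : ℝ) (u : ℝ → ℝ) : Prop :=
  ContinuousOn u (Set.Icc a b) ∧
  (∀ x ∈ Set.Icc a b, ∀ y ∈ Set.Icc a b, u y - u x = ∫ t in x..y, deriv u t) ∧
  MeasureTheory.IntegrableOn (fun x => (deriv u x) ^ 2) (Set.Icc a b)

/-- A piecewise constant function `v : [a,b] → {-1,1}` with exactly `N` jumps located at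
`a < h 0 < h 1 < … < h (N-1) < b`; it alternates between the values `±1`, starting from
the value `s` on the first subinterval. -/
structure TransitionLayer (a b : ℝ) (N : ℕ) where
  h : Fin N → ℝ
  s : ℝ
  hs : s = 1 ∨ s = -1
  hmono : StrictMono h
  hmem : ∀ i, h i ∈ Set.Ioo a b

noncomputable def TransitionLayer.v {a b : ℝ} {N : ℕ} (V : TransitionLayer a b N) (x : ℝ) : ℝ :=
  V.s * (-1 : ℝ) ^ (Finset.univ.filter (fun i => V.h i < x)).card

/-- The condition `r < (h_{i+1} - h_i)/2` for all `i`, `a ≤ h₁ - r` and `h_N + r ≤ b`. -/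
def TransitionLayer.rOK {a b : ℝ} {N : ℕ} (V : TransitionLayer a b N) (r : ℝ) : Prop :=
  0 < r ∧ (∀ i, a ≤ V.h i - r ∧ V.h i + r ≤ b) ∧
  ∀ i j : Fin N, (i : ℕ) + 1 = (j : ℕ) → 2 * r < V.h j - V.h i

/-- The antiderivative `g̃(x) = ∫_a^x g(y) dy`. -/
noncomputable def tilde (a : ℝ) (g : ℝ → ℝ) (x : ℝ) : ℝ := ∫ y in a..x, g y

lemma v_integrable {a b : ℝ} {N : ℕ} (V : TransitionLayer a b N) (x y : ℝ) :
    IntervalIntegrable V.v volume x y := by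
  have hm : Measurable V.v := by
    unfold TransitionLayer.v
    refine measurable_const.mul ?_
    have h1 : Measurable (fun n : ℕ => (-1 : ℝ) ^ n) := measurable_from_top
    refine h1.comp (g := fun n : ℕ => (-1 : ℝ) ^ n) ?_
    simp only [Finset.card_filter]
    refine Finset.measurable_sum _ (fun i _ => ?_)
    exact Measurable.ite measurableSet_Ioi measurable_const measurable_const
  have hb : ∀ t, ‖V.v t‖ ≤ 1 := by
    intro t
    unfold TransitionLayer.v
    rcases V.hs with h | h <;> simp [h]
  refine (intervalIntegrable_const (c := (1 : ℝ))).mono_fun hm.aestronglyMeasurable ?_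
  exact Eventually.of_forall (fun t => by simpa using hb t)

lemma key (a b p m c ρ : ℝ) (hab : a < b) (hm : 0 < m) (hap : a ≤ p) (hpb : p + 2 * m ≤ b)
    (hρ : 0 < ρ) (u v : ℝ → ℝ) (hu : ContinuousOn u (Icc a b)) (hv : IntervalIntegrable v volume a b)
    (hvc : ∀ x ∈ Ioo p (p + 2 * m), v x = c)
    (hno : ∀ x ∈ Ioo p (p + 2 * m), ρ ≤ |u x - c|) :
    ρ * m ^ 2 ≤ ∫ x in a..b, |tilde a u x - tilde a v x| := by
  have hui : IntervalIntegrable u volume a b := by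
    apply ContinuousOn.intervalIntegrable
    rwa [uIcc_of_le hab.le]
  have hsub : ∀ {w : ℝ → ℝ}, IntervalIntegrable w volume a b → ∀ x ∈ Icc a b, ∀ y ∈ Icc a b,
      IntervalIntegrable w volume x y := by
    intro w hw x hx y hy
    apply hw.mono_set
    rw [uIcc_of_le hab.le]
    exact uIcc_subset_Icc hx hy
  have haI : a ∈ Icc a b := ⟨le_rfl, hab.le⟩
  have hss : Ioo p (p + 2 * m) ⊆ Icc a b := fun x hx => ⟨by linarith [hx.1], by linarith [hx.2]⟩
  have hWc : ContinuousOn (fun x => |tilde a u x - tilde a v x|) (Icc a b) := by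
    have hc : ∀ {w : ℝ → ℝ}, IntervalIntegrable w volume a b →
        ContinuousOn (tilde a w) (Icc a b) := by
      intro w hw
      have := intervalIntegral.continuousOn_primitive_interval' hw (left_mem_uIcc)
      rw [uIcc_of_le hab.le] at this
      exact this
    exact ((hc hui).sub (hc hv)).abs
  have hWi : IntervalIntegrable (fun x => |tilde a u x - tilde a v x|) volume a b := by
    apply ContinuousOn.intervalIntegrable
    rwa [uIcc_of_le hab.le]
  -- sign
  have hcont : ContinuousOn (fun x => u x - c) (Ioo p (p + 2 * m)) :=
    (hu.mono hss).sub continuousOn_const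
  have hsign : (∀ x ∈ Ioo p (p + 2 * m), ρ ≤ u x - c) ∨
      (∀ x ∈ Ioo p (p + 2 * m), ρ ≤ -(u x - c)) := by
    by_contra hcon
    push Not at hcon
    obtain ⟨⟨x, hx, hx'⟩, ⟨y, hy, hy'⟩⟩ := hcon
    have h1 : u x - c ≤ 0 := by
      rcases le_abs.1 (hno x hx) with h | h <;> linarith
    have h2 : 0 ≤ u y - c := by
      rcases le_abs.1 (hno y hy) with h | h <;> linarith
    obtain ⟨z, hz, hz'⟩ := isPreconnected_Ioo.intermediate_value hx hy hcont ⟨h1, h2⟩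
    have := hno z hz
    simp only at hz'
    rw [hz', abs_zero] at this
    linarith
  have hpt : ∀ x ∈ Ioo p (p + m), ρ * m ≤ |tilde a u x - tilde a v x| +
      |tilde a u (x + m) - tilde a v (x + m)| := by
    intro x hx
    have hxI : x ∈ Icc a b := ⟨by linarith [hx.1], by linarith [hx.2]⟩
    have hyI : x + m ∈ Icc a b := ⟨by linarith [hx.1], by linarith [hx.2]⟩
    have hin : ∀ t ∈ Icc x (x + m), t ∈ Ioo p (p + 2 * m) := fun t ht =>
      ⟨by linarith [hx.1, ht.1], by linarith [hx.2, ht.2]⟩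
    have e1 : tilde a u (x + m) - tilde a u x = ∫ t in x..(x + m), u t :=
      intervalIntegral.integral_interval_sub_left (hsub hui a haI _ hyI) (hsub hui a haI _ hxI)
    have e2 : tilde a v (x + m) - tilde a v x = ∫ t in x..(x + m), v t :=
      intervalIntegral.integral_interval_sub_left (hsub hv a haI _ hyI) (hsub hv a haI _ hxI)
    have e3 : ∫ t in x..(x + m), v t = m * c := by
      have : ∫ t in x..(x + m), v t = ∫ t in x..(x + m), c := by
        apply intervalIntegral.integral_congr
        intro t ht
        rw [uIcc_of_le (by linarith)] at ht
        exact hvc t (hin t ht)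
      rw [this]; simp
    have hi := hsub hui x hxI _ hyI
    have hle : x ≤ x + m := by linarith
    rcases hsign with h | h
    · have : ∫ t in x..(x + m), (c + ρ) ≤ ∫ t in x..(x + m), u t :=
        intervalIntegral.integral_mono_on hle (by simp) hi
          (fun t ht => by linarith [h t (hin t ht)])
      simp at this
      have a1 := neg_abs_le (tilde a u x - tilde a v x)
      have a2 := le_abs_self (tilde a u (x + m) - tilde a v (x + m))
      have a3 := neg_abs_le (tilde a u (x+m) - tilde a v (x+m))
      have a4 := le_abs_self (tilde a u x - tilde a v x)
      nlinarith
    · have : ∫ t in x..(x + m), u t ≤ ∫ t in x..(x + m), (c - ρ) :=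
        intervalIntegral.integral_mono_on hle hi (by simp)
          (fun t ht => by linarith [h t (hin t ht)])
      simp at this
      have a1 := neg_abs_le (tilde a u x - tilde a v x)
      have a2 := le_abs_self (tilde a u (x + m) - tilde a v (x + m))
      have a3 := neg_abs_le (tilde a u (x+m) - tilde a v (x+m))
      have a4 := le_abs_self (tilde a u x - tilde a v x)
      nlinarith
  set F : ℝ → ℝ := fun x => |tilde a u x - tilde a v x| with hF
  have hp0 : p ∈ Icc a b := ⟨by linarith, by linarith⟩
  have hp1 : p + m ∈ Icc a b := ⟨by linarith, by linarith⟩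
  have hp2 : p + m + m ∈ Icc a b := ⟨by linarith, by linarith⟩
  have i1 := hsub hWi p hp0 _ hp1
  have i2 := hsub hWi (p + m) hp1 _ hp2
  have i3 : IntervalIntegrable (fun x => F (x + m)) volume p (p + m) := by
    have := i2.comp_add_right m
    simpa using this
  have hI : ∫ x in p..(p + m), ρ * m ≤ ∫ x in p..(p + m), (F x + F (x + m)) :=
    intervalIntegral.integral_mono_on_of_le_Ioo (by linarith) (by simp) (i1.add i3)
      (fun x hx => hpt x hx)
  rw [intervalIntegral.integral_add i1 i3, intervalIntegral.integral_comp_add_right F m,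
    intervalIntegral.integral_add_adjacent_intervals i1 i2] at hI
  have hfin : ∫ x in p..(p + m + m), F x ≤ ∫ x in a..b, F x :=
    intervalIntegral.integral_mono_interval hap (by linarith) hp2.2
      (Eventually.of_forall (fun x => abs_nonneg _)) hWi
  simp at hI
  nlinarith

theorem stmt10 (a b r rhat ρ : ℝ) (N : ℕ) (hab : a < b)
    (V : TransitionLayer a b N) (hr : V.rOK r) (i : Fin N)
    (hvm : ∀ x ∈ Set.Ioo (V.h i - r) (V.h i), V.v x = -1)
    (hvp : ∀ x ∈ Set.Ioo (V.h i) (V.h i + r), V.v x = 1)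
    (hrhat : rhat ∈ Set.Ioo (0 : ℝ) r) (hρ : 0 < ρ) :
    ∃ δ > (0 : ℝ), ∀ u : ℝ → ℝ, MemH1 a b u →
      (∫ x in a..b, |tilde a u x - tilde a V.v x|) ≤ δ →
      ∃ rp ∈ Set.Ioo (0 : ℝ) rhat, ∃ rm ∈ Set.Ioo (0 : ℝ) rhat,
        |u (V.h i + rp) - 1| < ρ ∧ |u (V.h i - rm) + 1| < ρ := by
  obtain ⟨hr0, hrI, -⟩ := hr
  obtain ⟨hI1, hI2⟩ := hrI i
  obtain ⟨hh0, hh1⟩ := hrhat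
  refine ⟨ρ * (rhat / 2) ^ 2 / 2, by positivity, fun u hu hd => ?_⟩
  have hpos : 0 < ρ * (rhat / 2) ^ 2 := by positivity
  have hP : ∃ rp ∈ Set.Ioo (0 : ℝ) rhat, |u (V.h i + rp) - 1| < ρ := by
    by_contra hcon
    push Not at hcon
    have := key a b (V.h i) (rhat / 2) 1 ρ hab (by linarith) (by linarith) (by linarith) hρ u V.v
      hu.1 (v_integrable V a b) (fun x hx => hvp x ⟨hx.1, by linarith [hx.2]⟩)
      (fun x hx => by
        have := hcon (x - V.h i) ⟨by linarith [hx.1], by linarith [hx.2]⟩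
        rwa [add_sub_cancel] at this)
    linarith
  have hM : ∃ rm ∈ Set.Ioo (0 : ℝ) rhat, |u (V.h i - rm) + 1| < ρ := by
    by_contra hcon
    push Not at hcon
    have := key a b (V.h i - rhat) (rhat / 2) (-1) ρ hab (by linarith) (by linarith)
      (by linarith) hρ u V.v
      hu.1 (v_integrable V a b) (fun x hx => hvm x ⟨by linarith [hx.1], by linarith [hx.2]⟩)
      (fun x hx => by
        have := hcon (V.h i - x) ⟨by linarith [hx.2], by linarith [hx.1]⟩
        rwa [sub_sub_cancel, ← sub_neg_eq_add] at this)
    linarith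
  obtain ⟨rp, hrp, h1⟩ := hP
  obtain ⟨rm, hrm, h2⟩ := hM
  exact ⟨rp, hrp, rm, hrm, h1, h2⟩
end
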